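/- Let M = (S, Act, P) be an MDP and rew : S → [0,∞] a reward function for M. For every state s, the supremum over n of the infimum over all schedulers and the infimum over all schedulers of the supremum over n of the n-step expected rewards commute: sup_{n∈ℕ} inf_𝔖 ER^{=n}_𝔖(rew, s) = inf_𝔖 sup_{n∈ℕ} ER^{=n}_𝔖(rew, s). -/

import Mathlib

open scoped ENNReal

noncomputable section

/-- A Markov decision process: countable state space `S`, finite action set `A`,
transition probability function `P` (values in `[0,1]`, represented in `ℝ≥0∞`)
such that each `P s a ·` is a finitely supported full or null distribution,
and every state has at least one enabled action. -/
structure MDP where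
  S : Type
  A : Type
  countableS : Countable S
  finiteA : Finite A
  P : S → A → S → ℝ≥0∞
  P_le_one : ∀ s a s', P s a s' ≤ 1
  finite_supp : ∀ s a, {s' | 0 < P s a s'}.Finite
  full_or_null : ∀ s a, (∑' s', P s a s') = 1 ∨ (∑' s', P s a s') = 0
  exists_enabled : ∀ s, ∃ a, (∑' s', P s a s') = 1

/-- Reward of a path: sum of the rewards of all its states. -/
def rewPath {σ : Type*} (rew : σ → ℝ≥0∞) (π : List σ) : ℝ≥0∞ := (π.map rew).sum

/-- Reward of the last state of a path (zero for the empty sequence). -/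
def lastRew {σ : Type*} (rew : σ → ℝ≥0∞) (π : List σ) : ℝ≥0∞ := π.getLast?.elim 0 rew

/-- Knaster–Tarski least fixed point of an endomap on a complete lattice. -/
def lfpOf {α : Type*} [CompleteLattice α] (Φ : α → α) : α := sInf {v | Φ v ≤ v}

namespace MDP

/-- The set of actions enabled in state `s`. -/
def Act (M : MDP) (s : M.S) : Set M.A := {a | (∑' s', M.P s a s') = 1}

/-- A scheduler assigns to every history (coded as the list of previously visited
states together with the current state; `𝔖 h s` is the choice for history `h ++ [s]`)
an action enabled in the current state. -/
def IsSched (M : MDP) (𝔖 : List M.S → M.S → M.A) : Prop :=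
  ∀ (h : List M.S) (s : M.S), 𝔖 h s ∈ M.Act s

/-- A scheduler is memoryless if its choice depends only on the last state. -/
def Memoryless (M : MDP) (𝔖 : List M.S → M.S → M.A) : Prop :=
  ∀ (h₁ h₂ : List M.S) (s : M.S), 𝔖 h₁ s = 𝔖 h₂ s

/-- The type of schedulers of `M`. -/
def Scheds (M : MDP) : Type := {𝔖 : List M.S → M.S → M.A // M.IsSched 𝔖}

/-- A path is a finite nonempty sequence of states such that each step is
possible via some enabled action. -/
def IsPath (M : MDP) : List M.S → Prop
  | [] => False
  | [_] => True
  | s :: s' :: rest => (∃ a ∈ M.Act s, 0 < M.P s a s') ∧ IsPath M (s' :: rest)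

/-- Probability of traversing the given remaining path, where `pref` is the
history of previously visited states. -/
def probAux (M : MDP) (𝔖 : List M.S → M.S → M.A) : List M.S → List M.S → ℝ≥0∞
  | _, [] => 1
  | _, [_] => 1
  | pref, s :: s' :: rest =>
      M.P s (𝔖 pref s) s' * probAux M 𝔖 (pref ++ [s]) (s' :: rest)

/-- The probability of a path under scheduler `𝔖` (the empty product is `1`). -/
def pathProb (M : MDP) (𝔖 : List M.S → M.S → M.A) (π : List M.S) : ℝ≥0∞ :=
  M.probAux 𝔖 [] π

/-- Paths of length exactly `n` (that is, `n` steps and `n + 1` states) starting in `s`. -/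
def PathsEq (M : MDP) (n : ℕ) (s : M.S) : Set (List M.S) :=
  {π | M.IsPath π ∧ π.head? = some s ∧ π.length = n + 1}

/-- Paths of length at most `n` starting in `s`. -/
def PathsLe (M : MDP) (n : ℕ) (s : M.S) : Set (List M.S) :=
  {π | M.IsPath π ∧ π.head? = some s ∧ π.length ≤ n + 1}

/-- All finite paths starting in `s`. -/
def Paths (M : MDP) (s : M.S) : Set (List M.S) :=
  {π | M.IsPath π ∧ π.head? = some s}

/-- Expected reward from `s` after exactly `n` steps under scheduler `𝔖`. -/
def ERn (M : MDP) (rew : M.S → ℝ≥0∞) (𝔖 : List M.S → M.S → M.A) (n : ℕ) (s : M.S) :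
    ℝ≥0∞ :=
  ∑' π : M.PathsEq n s, M.pathProb 𝔖 (π : List M.S) * rewPath rew (π : List M.S)

/-- Total expected reward from `s` under scheduler `𝔖`. -/
def ER (M : MDP) (rew : M.S → ℝ≥0∞) (𝔖 : List M.S → M.S → M.A) (s : M.S) : ℝ≥0∞ :=
  ⨆ n : ℕ, M.ERn rew 𝔖 n s

/-- Minimal expected reward from `s` after exactly `n` steps. -/
def MinERn (M : MDP) (rew : M.S → ℝ≥0∞) (n : ℕ) (s : M.S) : ℝ≥0∞ :=
  ⨅ 𝔖 : M.Scheds, M.ERn rew 𝔖.1 n s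

/-- Maximal expected reward from `s` after exactly `n` steps. -/
def MaxERn (M : MDP) (rew : M.S → ℝ≥0∞) (n : ℕ) (s : M.S) : ℝ≥0∞ :=
  ⨆ 𝔖 : M.Scheds, M.ERn rew 𝔖.1 n s

/-- Minimal (total) expected reward from `s`. -/
def MinER (M : MDP) (rew : M.S → ℝ≥0∞) (s : M.S) : ℝ≥0∞ :=
  ⨅ 𝔖 : M.Scheds, M.ER rew 𝔖.1 s

/-- Maximal (total) expected reward from `s`. -/
def MaxER (M : MDP) (rew : M.S → ℝ≥0∞) (s : M.S) : ℝ≥0∞ :=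
  ⨆ 𝔖 : M.Scheds, M.ER rew 𝔖.1 s

/-- The min-Bellman operator of `M` with respect to `rew`. -/
def bellmanMin (M : MDP) (rew : M.S → ℝ≥0∞) (v : M.S → ℝ≥0∞) : M.S → ℝ≥0∞ :=
  fun s => rew s + ⨅ a : M.Act s, ∑' s', M.P s a.1 s' * v s'

/-- The max-Bellman operator of `M` with respect to `rew`. -/
def bellmanMax (M : MDP) (rew : M.S → ℝ≥0∞) (v : M.S → ℝ≥0∞) : M.S → ℝ≥0∞ :=
  fun s => rew s + ⨆ a : M.Act s, ∑' s', M.P s a.1 s' * v s'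

end MDP

namespace MDP

variable (M : MDP) (rew : M.S → ℝ≥0∞)

/-- The lists of length `n + 1` split into their head and a tail of length `n`. -/
def consLengthEquiv (σ : Type) (n : ℕ) :
    σ × {l : List σ // l.length = n} ≃ {l : List σ // l.length = n + 1} :=
  Equiv.ofBijective (fun p => ⟨p.1 :: p.2.1, by simp [p.2.2]⟩) (by
    constructor
    · rintro ⟨a, l, hl⟩ ⟨b, m, hm⟩ h
      simpa using h
    · rintro ⟨l, hl⟩
      cases l with
      | nil => simp at hl
      | cons a l => exact ⟨(a, ⟨l, by simpa using hl⟩), rfl⟩)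

/-- A sum over lists of length `n + 1` is an iterated sum over heads and tails. -/
lemma tsum_length_succ {σ : Type} (n : ℕ) (f : List σ → ℝ≥0∞) :
    ∑' l : {l : List σ // l.length = n + 1}, f l =
      ∑' a, ∑' l : {l : List σ // l.length = n}, f (a :: l) := by
  rw [← (consLengthEquiv σ n).tsum_eq, ENNReal.tsum_prod']
  rfl

/-- A sum over lists of length `0` is the value at the empty list. -/
lemma tsum_length_zero {σ : Type} (f : List σ → ℝ≥0∞) :
    ∑' l : {l : List σ // l.length = 0}, f l = f [] := by
  rw [tsum_eq_single ⟨[], rfl⟩]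
  rintro ⟨l, hl⟩ h
  exact absurd (Subtype.ext (List.length_eq_zero_iff.1 hl)) h

variable {M}

/-- Sequences that are not paths have probability zero. -/
lemma isPath_of_probAux_ne_zero {𝔖 : List M.S → M.S → M.A} (h𝔖 : M.IsSched 𝔖) (l : List M.S) :
    ∀ (pref : List M.S) (s : M.S), M.probAux 𝔖 pref (s :: l) ≠ 0 → M.IsPath (s :: l) := by
  induction l with
  | nil => intro _ _ _; trivial
  | cons a l ih =>
    intro pref s h
    rw [probAux] at h
    exact ⟨⟨_, h𝔖 pref s, pos_iff_ne_zero.2 (left_ne_zero_of_mul h)⟩,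
      ih _ _ (right_ne_zero_of_mul h)⟩

/-- The path probabilities of a fixed length add up to one. -/
lemma tsum_probAux {𝔖 : List M.S → M.S → M.A} (h𝔖 : M.IsSched 𝔖) (n : ℕ) :
    ∀ (pref : List M.S) (s : M.S),
      ∑' l : {l : List M.S // l.length = n}, M.probAux 𝔖 pref (s :: l) = 1 := by
  induction n with
  | zero =>
    intro pref s
    exact tsum_length_zero fun l => M.probAux 𝔖 pref (s :: l)
  | succ n ih =>
    intro pref s
    rw [tsum_length_succ n fun l => M.probAux 𝔖 pref (s :: l)]
    simp only [probAux, ENNReal.tsum_mul_left, ih, mul_one]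
    exact h𝔖 pref s

variable (M)

/-- The expected reward of the next `n` steps from `s` after the history `pref`. -/
def expRew (𝔖 : List M.S → M.S → M.A) : ℕ → List M.S → M.S → ℝ≥0∞
  | 0, _, s => rew s
  | n + 1, pref, s => rew s + ∑' s', M.P s (𝔖 pref s) s' * expRew 𝔖 n (pref ++ [s]) s'

variable {M}

lemma tsum_probAux_mul_rewPath {𝔖 : List M.S → M.S → M.A} (h𝔖 : M.IsSched 𝔖) (n : ℕ) :
    ∀ (pref : List M.S) (s : M.S),
      ∑' l : {l : List M.S // l.length = n}, M.probAux 𝔖 pref (s :: l) * rewPath rew (s :: l) =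
        M.expRew rew 𝔖 n pref s := by
  induction n with
  | zero =>
    intro pref s
    rw [tsum_length_zero fun l => M.probAux 𝔖 pref (s :: l) * rewPath rew (s :: l)]
    simp [probAux, rewPath, expRew]
  | succ n ih =>
    intro pref s
    have hcons (l : List M.S) : rewPath rew (s :: l) = rew s + rewPath rew l := by
      simp [rewPath]
    simp only [hcons, mul_add]
    rw [ENNReal.tsum_add, ENNReal.tsum_mul_right, tsum_probAux h𝔖, one_mul, expRew,
      tsum_length_succ n fun l => M.probAux 𝔖 pref (s :: l) * rewPath rew l]
    simp only [probAux, mul_assoc, ENNReal.tsum_mul_left, ih]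

/-- The `n`-step expected reward satisfies the recursion defining `expRew`. -/
lemma ERn_eq_expRew {𝔖 : List M.S → M.S → M.A} (h𝔖 : M.IsSched 𝔖) (n : ℕ) (s : M.S) :
    M.ERn rew 𝔖 n s = M.expRew rew 𝔖 n [] s := by
  rw [← tsum_probAux_mul_rewPath rew h𝔖, ERn,
    tsum_subtype (M.PathsEq n s) fun π => M.pathProb 𝔖 π * rewPath rew π]
  have hinj : Function.Injective fun l : {l : List M.S // l.length = n} => s :: l.1 := by
    intro l m h
    exact Subtype.ext (List.cons_injective h)
  rw [← hinj.tsum_eq]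
  · refine tsum_congr fun l => ?_
    by_cases h : M.probAux 𝔖 [] (s :: l) = 0
    · simp [pathProb, h]
    · rw [Set.indicator_of_mem]
      · rfl
      · exact ⟨isPath_of_probAux_ne_zero h𝔖 _ _ _ h, rfl, by simp [l.2]⟩
  · intro π hπ
    obtain ⟨-, hhead, hlen⟩ := Set.mem_of_indicator_ne_zero hπ
    cases π with
    | nil => simp at hhead
    | cons a l =>
      obtain rfl : a = s := by simpa using hhead
      exact ⟨⟨l, by simpa using hlen⟩, rfl⟩

variable (M)

/-- Value iteration for the min-Bellman operator, started at the reward function. -/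
def valueIter (n : ℕ) : M.S → ℝ≥0∞ := (M.bellmanMin rew)^[n] rew

lemma valueIter_succ (n : ℕ) :
    M.valueIter rew (n + 1) = M.bellmanMin rew (M.valueIter rew n) :=
  Function.iterate_succ_apply' _ _ _

lemma bellmanMin_mono : Monotone (M.bellmanMin rew) := by
  intro v w h s
  unfold bellmanMin
  gcongr
  exact h _

lemma valueIter_mono : Monotone (M.valueIter rew) :=
  (M.bellmanMin_mono rew).monotone_iterate_of_le_map fun _ => le_self_add

variable {M}

lemma valueIter_le_expRew {𝔖 : List M.S → M.S → M.A} (h𝔖 : M.IsSched 𝔖) (n : ℕ) :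
    ∀ (pref : List M.S) (s : M.S), M.valueIter rew n s ≤ M.expRew rew 𝔖 n pref s := by
  induction n with
  | zero => intro _ _; exact le_rfl
  | succ n ih =>
    intro pref s
    rw [valueIter_succ, bellmanMin, expRew]
    gcongr
    refine (iInf_le _ (⟨𝔖 pref s, h𝔖 pref s⟩ : M.Act s)).trans ?_
    gcongr
    exact ih _ _

variable (M)

/-- In every state some enabled action is optimal for the limit of value iteration. -/
lemma exists_act_le_iSup_valueIter (s : M.S) :
    ∃ a ∈ M.Act s, rew s + ∑' s', M.P s a s' * ⨆ n, M.valueIter rew n s' ≤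
      ⨆ n, M.valueIter rew n s := by
  have := M.finiteA
  obtain ⟨a₀, ha₀⟩ := M.exists_enabled s
  have : Nonempty (M.Act s) := ⟨⟨a₀, ha₀⟩⟩
  choose act hact using fun n =>
    exists_eq_ciInf_of_finite (f := fun a : M.Act s => ∑' s', M.P s a.1 s' * M.valueIter rew n s')
  obtain ⟨a, ha⟩ := Finite.exists_infinite_fiber act
  have hinf : (act ⁻¹' {a}).Infinite := Set.infinite_coe_iff.1 ha
  refine ⟨a, a.2, ?_⟩
  have hle (n : ℕ) : rew s + ∑' s', M.P s a s' * M.valueIter rew n s' ≤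
      ⨆ n, M.valueIter rew n s := by
    obtain ⟨m, hm, hnm⟩ := hinf.exists_gt n
    obtain rfl : act m = a := hm
    calc rew s + ∑' s', M.P s (act m) s' * M.valueIter rew n s'
        ≤ rew s + ∑' s', M.P s (act m) s' * M.valueIter rew m s' := by
          gcongr
          exact M.valueIter_mono rew hnm.le _
      _ = M.valueIter rew (m + 1) s := by rw [hact, valueIter_succ, bellmanMin]
      _ ≤ ⨆ n, M.valueIter rew n s := le_iSup (fun n => M.valueIter rew n s) (m + 1)
  have hsum : ∑' s', M.P s a s' * ⨆ n, M.valueIter rew n s' =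
      ⨆ n, ∑' s', M.P s a s' * M.valueIter rew n s' := by
    simp only [ENNReal.mul_iSup, ENNReal.tsum_eq_iSup_sum]
    rw [iSup_comm]
    refine iSup_congr fun t => ENNReal.finsetSum_iSup_of_monotone fun s' i j hij => ?_
    gcongr
    exact M.valueIter_mono rew hij _
  rw [hsum, ENNReal.add_iSup]
  exact iSup_le hle

/-- A memoryless scheduler bounds all expected rewards by the limit of value iteration. -/
lemma exists_sched_expRew_le :
    ∃ 𝔖 : M.Scheds, ∀ n pref s, M.expRew rew 𝔖.1 n pref s ≤ ⨆ m, M.valueIter rew m s := by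
  choose act hact hle using M.exists_act_le_iSup_valueIter rew
  refine ⟨⟨fun _ s => act s, fun _ s => hact s⟩, fun n => ?_⟩
  induction n with
  | zero => exact fun _ s => le_iSup (fun m => M.valueIter rew m s) 0
  | succ n ih =>
    intro pref s
    rw [expRew]
    refine le_trans ?_ (hle s)
    gcongr
    exact ih _ _

end MDP

/-- For every state `s`, the supremum over `n` of the infimum over
all schedulers of the `n`-step expected rewards and the infimum over all schedulers of
the supremum over `n` commute:
`⨆ n, ⨅ 𝔖, ER⁼ⁿ_𝔖(rew, s) = ⨅ 𝔖, ⨆ n, ER⁼ⁿ_𝔖(rew, s)`. -/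
theorem iSup_iInf_ERn_comm (M : MDP) (rew : M.S → ℝ≥0∞) (s : M.S) :
    (⨆ n : ℕ, ⨅ 𝔖 : M.Scheds, M.ERn rew 𝔖.1 n s) =
      ⨅ 𝔖 : M.Scheds, ⨆ n : ℕ, M.ERn rew 𝔖.1 n s := by
  apply le_antisymm (iSup_iInf_le_iInf_iSup _)
  obtain ⟨𝔖, h𝔖⟩ := M.exists_sched_expRew_le rew
  calc ⨅ 𝔖 : M.Scheds, ⨆ n : ℕ, M.ERn rew 𝔖.1 n s
      ≤ ⨆ n : ℕ, M.ERn rew 𝔖.1 n s := iInf_le _ 𝔖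
    _ ≤ ⨆ n : ℕ, M.valueIter rew n s :=
        iSup_le fun n => (MDP.ERn_eq_expRew rew 𝔖.2 n s).trans_le (h𝔖 n [] s)
    _ ≤ ⨆ n : ℕ, ⨅ 𝔖 : M.Scheds, M.ERn rew 𝔖.1 n s :=
        iSup_mono fun n => le_iInf fun 𝔗 =>
          (MDP.valueIter_le_expRew rew 𝔗.2 n [] s).trans_eq (MDP.ERn_eq_expRew rew 𝔗.2 n s).symm
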